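/- arXiv:1111.6422 — 2 statements merged into one kernel-verified Lean document; each statement's English description precedes it below -/
import Mathlib

section
/- Let k ≥ 1 and 0 ≤ m ≤ k. Then in ℚ[[q]]: Σ_{λ_1 ≥ … ≥ λ_k ≥ 0} (q^{Σ_{i=1}^k (λ_i² + λ_i)} / (q)_λ) · (1 + Σ_{i=0}^{m−1} q^{Σ_{j=0}^{i} (λ_{k−j} + 1)}) = ∏_{n ≥ 1, n ≢ 0, ±(m+1) (mod 2k+3)} 1/(1 − q^n). -/
open PowerSeries

noncomputable section

/-- The product (coefficientwise) topology on `ℚ⟦X⟧`. -/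
instance : TopologicalSpace ℚ⟦X⟧ :=
  inferInstanceAs (TopologicalSpace ((Unit →₀ ℕ) → ℚ))

/-- `(q)_n = ∏_{i=1}^n (1 - q^i)` in `ℚ⟦X⟧`. -/
def qp (n : ℕ) : ℚ⟦X⟧ := ∏ i ∈ Finset.range n, (1 - X ^ (i + 1))

/-- `(-q)_n = ∏_{i=1}^n (1 + q^i)` in `ℚ⟦X⟧`. -/
def nqp (n : ℕ) : ℚ⟦X⟧ := ∏ i ∈ Finset.range n, (1 + X ^ (i + 1))

/-- The Gaussian binomial `[M, N]_q`, zero unless `M ≥ N`. -/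
def qbinom (M N : ℕ) : ℚ⟦X⟧ :=
  if N ≤ M then qp M * ((qp N)⁻¹ * (qp (M - N))⁻¹) else 0

/-- Weakly decreasing tuples `f 0 ≥ f 1 ≥ … ≥ f (r-1) ≥ 0`, encoded as
antitone functions `ℕ → ℕ` vanishing from index `r` on. -/
def DecTuple (r : ℕ) : Type :=
  {f : ℕ → ℕ // (∀ ⦃i j : ℕ⦄, i ≤ j → f j ≤ f i) ∧ ∀ i, r ≤ i → f i = 0}

/-- `(q)_λ = (q)_{λ_1-λ_2} ⋯ (q)_{λ_{r-1}-λ_r} (q)_{λ_r}` for a weakly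
decreasing tuple `λ` (0-indexed). -/
def qpT (r : ℕ) (f : ℕ → ℕ) : ℚ⟦X⟧ := ∏ i ∈ Finset.range r, qp (f i - f (i + 1))

/-- The inverse of the `Q`-shifted factorial `∏_{i=1}^n (1 - Q^i)`. -/
def invQ (Q : ℚ⟦X⟧) (n : ℕ) : ℚ⟦X⟧ := (∏ i ∈ Finset.range n, (1 - Q ^ (i + 1)))⁻¹

lemma invQ_zero (Q : ℚ⟦X⟧) : invQ Q 0 = 1 := by
  simp [invQ]

lemma one_sub_pow_ne_zero {Q : ℚ⟦X⟧} (hQ : constantCoeff Q = 0) (n : ℕ) :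
    (1 - Q ^ (n + 1) : ℚ⟦X⟧) ≠ 0 := by
  intro h
  have := congrArg (constantCoeff (R := ℚ)) h
  simp [hQ] at this

lemma prod_mul_invQ {Q : ℚ⟦X⟧} (hQ : constantCoeff Q = 0) (n : ℕ) :
    (∏ i ∈ Finset.range n, (1 - Q ^ (i + 1))) * invQ Q n = 1 := by
  refine PowerSeries.mul_inv_cancel _ ?_
  simp [map_prod, hQ]

lemma one_sub_mul_invQ {Q : ℚ⟦X⟧} (hQ : constantCoeff Q = 0) (n : ℕ) :
    (1 - Q ^ (n + 1)) * invQ Q (n + 1) = invQ Q n := by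
  have h1 := prod_mul_invQ hQ n
  have h2 := prod_mul_invQ hQ (n + 1)
  rw [Finset.prod_range_succ] at h2
  linear_combination invQ Q n * h2 - (1 - Q ^ (n + 1)) * invQ Q (n + 1) * h1

/-- The `q`-Chu–Vandermonde summation. -/
lemma sum_antidiagonal_invQ {Q : ℚ⟦X⟧} (hQ : constantCoeff Q = 0) (A B : ℕ) :
    ∑ p ∈ Finset.HasAntidiagonal.antidiagonal A,
      Q ^ (p.1 * (p.1 + B)) * (invQ Q p.2 * invQ Q p.1 * invQ Q (p.1 + B)) =
      invQ Q A * invQ Q (A + B) := by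
  induction A generalizing B with
  | zero => simp [invQ_zero]
  | succ A ih =>
    apply mul_left_cancel₀ (one_sub_pow_ne_zero hQ A)
    have key : ∀ p ∈ Finset.HasAntidiagonal.antidiagonal (A + 1),
        (1 - Q ^ (A + 1)) *
          (Q ^ (p.1 * (p.1 + B)) * (invQ Q p.2 * invQ Q p.1 * invQ Q (p.1 + B))) =
        Q ^ (p.1 * (p.1 + B)) * (((1 - Q ^ p.2) * invQ Q p.2) * invQ Q p.1 * invQ Q (p.1 + B)) +
        Q ^ (p.1 * (p.1 + B) + p.2) *
          (invQ Q p.2 * ((1 - Q ^ p.1) * invQ Q p.1) * invQ Q (p.1 + B)) := by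
      intro p hp
      rw [← Finset.HasAntidiagonal.mem_antidiagonal.mp hp, pow_add, pow_add]
      ring
    rw [Finset.mul_sum, Finset.sum_congr rfl key, Finset.sum_add_distrib,
      Finset.Nat.sum_antidiagonal_succ', Finset.Nat.sum_antidiagonal_succ]
    simp only [one_sub_mul_invQ hQ, pow_zero, sub_self, zero_mul, mul_zero, zero_add]
    have h2 : ∀ p ∈ Finset.HasAntidiagonal.antidiagonal A,
        Q ^ ((p.1 + 1) * (p.1 + 1 + B) + p.2) *
          (invQ Q p.2 * invQ Q p.1 * invQ Q (p.1 + 1 + B)) =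
        Q ^ (A + 1 + B) * (Q ^ (p.1 * (p.1 + (B + 1))) *
          (invQ Q p.2 * invQ Q p.1 * invQ Q (p.1 + (B + 1)))) := by
      intro p hp
      rw [← Finset.HasAntidiagonal.mem_antidiagonal.mp hp,
        show p.1 + 1 + B = p.1 + (B + 1) by ring, ← mul_assoc (Q ^ (p.1 + p.2 + 1 + B)), ← pow_add]
      congr 2
      ring
    rw [Finset.sum_congr rfl h2, ← Finset.mul_sum, ih, ih, show A + (B + 1) = A + B + 1 by ring,
      show A + 1 + B = A + B + 1 by ring]
    linear_combination (-invQ Q A) * one_sub_mul_invQ hQ (A + B) -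
      invQ Q (A + B + 1) * one_sub_mul_invQ hQ A

/-- The kernel `1 / ((q)_{s-j} (q)_{s+j+b})` of a Bailey pair relative to `q^b`. -/
def kernel (b s j : ℕ) : ℚ⟦X⟧ := if j ≤ s then invQ X (s - j) * invQ X (s + j + b) else 0

lemma kernel_of_lt {b s j : ℕ} (h : s < j) : kernel b s j = 0 := if_neg (by omega)

/-- The `β`-sequence of the Bailey pair relative to `q^b` with `α`-sequence `a`. -/
def baileyBeta (b : ℕ) (a : ℕ → ℚ⟦X⟧) (s : ℕ) : ℚ⟦X⟧ :=
  ∑ j ∈ Finset.range (s + 1), a j * kernel b s j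

lemma sum_kernel (b N j : ℕ) :
    ∑ t ∈ Finset.range (N + 1), X ^ (t ^ 2 + b * t) * invQ X (N - t) * kernel b t j =
      X ^ (j ^ 2 + b * j) * kernel b N j := by
  rcases lt_or_ge N j with h | h
  · rw [kernel_of_lt h, mul_zero]
    refine Finset.sum_eq_zero fun t ht => ?_
    rw [kernel_of_lt (by grind), mul_zero]
  obtain ⟨A, rfl⟩ := Nat.exists_eq_add_of_le h
  have hX : constantCoeff (X : ℚ⟦X⟧) = 0 := by simp
  have key := sum_antidiagonal_invQ hX A (2 * j + b)
  rw [Finset.Nat.sum_antidiagonal_eq_sum_range_succ (fun i l =>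
    (X : ℚ⟦X⟧) ^ (i * (i + (2 * j + b))) * (invQ X l * invQ X i * invQ X (i + (2 * j + b))))]
    at key
  rw [add_assoc, Finset.sum_range_add, Finset.sum_eq_zero, zero_add, kernel, if_pos h,
    show j + A - j = A by omega, show j + A + j + b = A + (2 * j + b) by ring, ← key,
    Finset.mul_sum]
  · refine Finset.sum_congr rfl fun i _ => ?_
    rw [kernel, if_pos (by omega), show j + A - (j + i) = A - i by omega,
      show j + i - j = i by omega, show j + i + j + b = i + (2 * j + b) by ring,
      show (j + i) ^ 2 + b * (j + i) = (j ^ 2 + b * j) + i * (i + (2 * j + b)) by ring, pow_add]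
    ring
  · intro t ht
    rw [kernel_of_lt (by grind), mul_zero]

lemma baileyBeta_eq_sum_range {b s N : ℕ} (a : ℕ → ℚ⟦X⟧) (h : s ≤ N) :
    baileyBeta b a s = ∑ j ∈ Finset.range (N + 1), a j * kernel b s j := by
  refine Finset.sum_subset (Finset.range_mono (by omega)) fun j _ hj => ?_
  rw [kernel_of_lt (by grind), mul_zero]

/-- The Bailey lemma. -/
lemma sum_baileyBeta (b N : ℕ) (a : ℕ → ℚ⟦X⟧) :
    ∑ t ∈ Finset.range (N + 1), X ^ (t ^ 2 + b * t) * invQ X (N - t) * baileyBeta b a t =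
      baileyBeta b (fun j => X ^ (j ^ 2 + b * j) * a j) N := by
  have h : ∀ t ∈ Finset.range (N + 1),
      X ^ (t ^ 2 + b * t) * invQ X (N - t) * baileyBeta b a t =
      ∑ j ∈ Finset.range (N + 1),
        a j * (X ^ (t ^ 2 + b * t) * invQ X (N - t) * kernel b t j) := by
    intro t ht
    rw [baileyBeta_eq_sum_range a (by grind : t ≤ N), Finset.mul_sum]
    exact Finset.sum_congr rfl fun j _ => by ring
  rw [Finset.sum_congr rfl h, Finset.sum_comm]
  refine Finset.sum_congr rfl fun j _ => ?_
  rw [← Finset.mul_sum, sum_kernel]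
  ring

lemma baileyBeta_congr {b s : ℕ} {a a' : ℕ → ℚ⟦X⟧} (h : ∀ j, a j = a' j) :
    baileyBeta b a s = baileyBeta b a' s := by
  rw [funext h]

/-- The unit Bailey pair relative to `q`. -/
def unitAlphaOne (j : ℕ) : ℚ⟦X⟧ := (-1) ^ j * X ^ j.choose 2 * (1 - X ^ (2 * j + 1))

/-- The unit Bailey pair relative to `q^2`. -/
def unitAlphaTwo (j : ℕ) : ℚ⟦X⟧ :=
  (-1) ^ j * X ^ j.choose 2 * (1 - X ^ (j + 1)) * (1 - X ^ (2 * j + 2))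

lemma choose_two_succ (j : ℕ) : (j + 1).choose 2 = j.choose 2 + j := by
  rw [Nat.choose_succ_succ' j 1, Nat.choose_one_right, add_comm]

lemma one_sub_mul_kernel (b s j : ℕ) (h : j + 1 ≤ s) :
    (1 - X ^ (s - j)) * kernel b s j = (1 - X ^ (s + j + 1 + b)) * kernel b s (j + 1) := by
  have hX : constantCoeff (X : ℚ⟦X⟧) = 0 := by simp
  obtain ⟨A, rfl⟩ := Nat.exists_eq_add_of_le h
  have h1 := one_sub_mul_invQ hX A
  have h2 := one_sub_mul_invQ hX (j + 1 + A + j + b)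
  rw [kernel, kernel, if_pos (by omega), if_pos (by omega)]
  rw [show j + 1 + A - j = A + 1 by omega, show j + 1 + A - (j + 1) = A by omega,
    show j + 1 + A + j + 1 + b = j + 1 + A + j + b + 1 by ring,
    show j + 1 + A + (j + 1) + b = j + 1 + A + j + b + 1 by ring, ← h1, ← h2]
  ring

lemma baileyBeta_unitAlphaOne (s : ℕ) :
    baileyBeta 1 unitAlphaOne s = if s = 0 then 1 else 0 := by
  have hX : constantCoeff (X : ℚ⟦X⟧) = 0 := by simp
  split_ifs with hs
  · subst hs
    have := one_sub_mul_invQ hX 0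
    simpa [baileyBeta, kernel, unitAlphaOne, invQ_zero] using this
  obtain ⟨s, rfl⟩ := Nat.exists_eq_succ_of_ne_zero hs
  apply mul_left_cancel₀ (one_sub_pow_ne_zero hX s)
  have key : ∀ J ≤ s + 1, (1 - X ^ (s + 1)) *
      ∑ j ∈ Finset.range (J + 1), unitAlphaOne j * kernel 1 (s + 1) j =
      (-1) ^ J * X ^ (J + 1).choose 2 * (1 - X ^ (J + 1)) *
        ((1 - X ^ (s + 1 - J)) * kernel 1 (s + 1) J) := by
    intro J
    induction J with
    | zero => intro _; simp [unitAlphaOne]; ring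
    | succ J ih =>
      intro hJ
      rw [Finset.sum_range_succ, mul_add, ih (by omega), one_sub_mul_kernel _ _ _ hJ,
        unitAlphaOne, choose_two_succ (J + 1)]
      obtain ⟨A, hA⟩ := Nat.exists_eq_add_of_le hJ
      rw [hA, show J + 1 + A - (J + 1) = A by omega]
      ring
  have h := key (s + 1) le_rfl
  simpa [baileyBeta] using h

lemma baileyBeta_unitAlphaTwo (s : ℕ) :
    baileyBeta 2 unitAlphaTwo s = if s = 0 then 1 else 0 := by
  have hX : constantCoeff (X : ℚ⟦X⟧) = 0 := by simp
  split_ifs with hs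
  · subst hs
    have h1 := one_sub_mul_invQ hX 0
    have h2 := one_sub_mul_invQ hX 1
    rw [invQ_zero] at h1
    simp only [baileyBeta, kernel, unitAlphaTwo, Finset.sum_range_succ,
      Finset.range_zero, Finset.sum_empty]
    norm_num [invQ_zero] at h1 h2 ⊢
    linear_combination (1 - X) * h2 + h1
  obtain ⟨s, rfl⟩ := Nat.exists_eq_succ_of_ne_zero hs
  apply mul_left_cancel₀ (one_sub_pow_ne_zero hX s)
  have key : ∀ J ≤ s + 1, (1 - X ^ (s + 1)) *
      ∑ j ∈ Finset.range (J + 1), unitAlphaTwo j * kernel 2 (s + 1) j =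
      (-1) ^ J * X ^ (J + 1).choose 2 * (1 - X ^ (J + 1)) * (1 - X ^ (J + 2)) *
        ((1 - X ^ (s + 1 - J)) * kernel 2 (s + 1) J) := by
    intro J
    induction J with
    | zero => intro _; simp [unitAlphaTwo]; ring
    | succ J ih =>
      intro hJ
      rw [Finset.sum_range_succ, mul_add, ih (by omega), one_sub_mul_kernel _ _ _ hJ,
        unitAlphaTwo, choose_two_succ (J + 1)]
      obtain ⟨A, hA⟩ := Nat.exists_eq_add_of_le hJ
      rw [hA, show J + 1 + A - (J + 1) = A by omega]
      ring
  have h := key (s + 1) le_rfl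
  simpa [baileyBeta] using h

/-- The nested sum `∑ ∏_i q^{t_i^2 + b_i t_i} / ((q)_{N-t_0} (q)_{t_0-t_1} ⋯ (q)_{t_{r-1}})` over
`N ≥ t_0 ≥ … ≥ t_{r-1} ≥ 0`. -/
def chainSum : ℕ → (ℕ → ℕ) → ℕ → ℚ⟦X⟧
  | 0, _, N => invQ X N
  | r + 1, b, N => ∑ t ∈ Finset.range (N + 1),
      X ^ (t ^ 2 + b 0 * t) * invQ X (N - t) * chainSum r (fun i => b (i + 1)) t

lemma chainSum_const {b : ℕ} {a : ℕ → ℚ⟦X⟧}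
    (h : ∀ s, baileyBeta b a s = if s = 0 then 1 else 0) (r N : ℕ) :
    chainSum r (fun _ => b) N =
      baileyBeta b (fun j => X ^ ((r + 1) * (j ^ 2 + b * j)) * a j) N := by
  induction r generalizing N with
  | zero =>
    simp only [zero_add, one_mul]
    rw [← sum_baileyBeta]
    simp [h, chainSum]
  | succ r ih =>
    rw [chainSum]
    simp only [ih]
    rw [sum_baileyBeta]
    refine baileyBeta_congr fun j => ?_
    rw [add_mul (r + 1), one_mul, pow_add]
    ring

/-- The sequence `c_j X^{j+1} - c_{j-1} X^j`. -/
def lowerAlpha (c : ℕ → ℚ⟦X⟧) : ℕ → ℚ⟦X⟧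
  | 0 => c 0 * X
  | j + 1 => c (j + 1) * X ^ (j + 2) - c j * X ^ (j + 1)

lemma kernel_two (s j : ℕ) :
    X ^ (s + 1) * ((1 - X ^ (2 * j + 2)) * kernel 2 s j) =
      X ^ (j + 1) * (kernel 1 s j - kernel 1 s (j + 1)) := by
  have hX : constantCoeff (X : ℚ⟦X⟧) = 0 := by simp
  rcases lt_trichotomy s j with h | h | h
  · rw [kernel_of_lt h, kernel_of_lt h, kernel_of_lt (by omega)]; simp
  · subst h
    have h1 := one_sub_mul_invQ hX (s + s + 1)
    rw [kernel_of_lt (Nat.lt_succ_self s), kernel, kernel, if_pos le_rfl, if_pos le_rfl, ← h1]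
    ring
  · obtain ⟨A, rfl⟩ := Nat.exists_eq_add_of_le (Nat.succ_le_of_lt h)
    have h1 := one_sub_mul_invQ hX A
    have h2 := one_sub_mul_invQ hX (j + 1 + A + j + 1)
    rw [kernel, kernel, kernel, if_pos h.le, if_pos h.le, if_pos (Nat.succ_le_of_lt h),
      show j.succ + A - j = A + 1 by omega, show j.succ + A - (j + 1) = A by omega,
      show j.succ + A + (j + 1) + 1 = j + 1 + A + j + 1 + 1 by omega,
      show j.succ + A + j + 2 = j + 1 + A + j + 1 + 1 by omega,
      show j.succ + A + j + 1 = j + 1 + A + j + 1 by omega, ← h1, ← h2,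
      Nat.succ_eq_add_one]
    ring

lemma X_pow_mul_baileyBeta_two (c : ℕ → ℚ⟦X⟧) (s : ℕ) :
    X ^ (s + 1) * baileyBeta 2 (fun j => c j * (1 - X ^ (2 * j + 2))) s =
      baileyBeta 1 (lowerAlpha c) s := by
  have key : ∀ J, ∑ j ∈ Finset.range (J + 1),
      c j * (X ^ (j + 1) * (kernel 1 s j - kernel 1 s (j + 1))) =
      ∑ j ∈ Finset.range (J + 1), lowerAlpha c j * kernel 1 s j
        - c J * X ^ (J + 1) * kernel 1 s (J + 1) := by
    intro J
    induction J with
    | zero => simp [lowerAlpha]; ring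
    | succ J ih =>
      rw [Finset.sum_range_succ, ih, Finset.sum_range_succ _ (J + 1), lowerAlpha]
      ring
  have h := key s
  rw [kernel_of_lt (Nat.lt_succ_self s), mul_zero, sub_zero] at h
  rw [baileyBeta, baileyBeta, ← h, Finset.mul_sum]
  refine Finset.sum_congr rfl fun j _ => ?_
  rw [← kernel_two]
  ring

/-- The `α`-sequence attached to a chain with `r + 1` shifted levels, see
`chainSum_ite`. -/
def shiftAlpha (r : ℕ) : ℕ → ℚ⟦X⟧ :=
  lowerAlpha fun j =>
    (-1) ^ j * X ^ ((r + 1) * (j ^ 2 + 2 * j) + j.choose 2 + r) * (1 - X ^ (j + 1))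

lemma chainSum_ite (p r N : ℕ) :
    X ^ (r + 1) * chainSum (p + 1 + r) (fun l => if l < p then 1 else 2) N =
      baileyBeta 1 (fun j => X ^ ((p + 1) * (j ^ 2 + j)) * shiftAlpha r j) N := by
  induction p generalizing N with
  | zero =>
    have h : ∀ t, X ^ (t + 1) * (X ^ r * chainSum r (fun _ => 2) t) =
        baileyBeta 1 (shiftAlpha r) t := by
      intro t
      rw [shiftAlpha, ← X_pow_mul_baileyBeta_two, chainSum_const baileyBeta_unitAlphaTwo,
        baileyBeta, baileyBeta, Finset.mul_sum]
      congr 1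
      refine Finset.sum_congr rfl fun j _ => ?_
      rw [unitAlphaTwo, pow_add _ _ r, pow_add _ _ (j.choose 2)]
      ring
    rw [show 0 + 1 + r = r + 1 by omega, chainSum, Finset.mul_sum]
    simp only [Nat.not_lt_zero, if_false]
    rw [show (fun j => (X : ℚ⟦X⟧) ^ ((0 + 1) * (j ^ 2 + j)) * shiftAlpha r j) =
      fun j => X ^ (j ^ 2 + 1 * j) * shiftAlpha r j by simp, ← sum_baileyBeta]
    refine Finset.sum_congr rfl fun t _ => ?_
    rw [← h, show t ^ 2 + 2 * t = (t ^ 2 + 1 * t) + t by ring, pow_add _ _ t]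
    ring
  | succ p ih =>
    rw [show p + 1 + 1 + r = (p + 1 + r) + 1 by omega, chainSum, Finset.mul_sum]
    simp only [Nat.succ_pos, if_true, Nat.add_lt_add_iff_right]
    have h : ∀ t ∈ Finset.range (N + 1), X ^ (r + 1) * (X ^ (t ^ 2 + 1 * t) * invQ X (N - t) *
        chainSum (p + 1 + r) (fun l => if l < p then 1 else 2) t) =
        X ^ (t ^ 2 + 1 * t) * invQ X (N - t) *
        baileyBeta 1 (fun j => X ^ ((p + 1) * (j ^ 2 + j)) * shiftAlpha r j) t := by
      intro t _
      rw [← ih]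
      ring
    rw [Finset.sum_congr rfl h, sum_baileyBeta]
    refine baileyBeta_congr fun j => ?_
    rw [add_mul (p + 1), one_mul, one_mul, pow_add]
    ring

/-- The general term of the theta series on the product side. -/
def thetaTerm (k m j : ℕ) : ℚ⟦X⟧ :=
  (-1) ^ j * X ^ ((2 * k + 3) * j.choose 2 + (2 * k + 2 - m) * j) *
    (1 - X ^ ((m + 1) * (2 * j + 1)))

lemma sq_eq_choose_two (j : ℕ) : j ^ 2 = 2 * j.choose 2 + j := by
  induction j with
  | zero => rfl
  | succ j ih => rw [choose_two_succ]; linear_combination ih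

lemma thetaTerm_succ (m l j : ℕ) :
    thetaTerm (m + 1 + l) m j + X ^ ((l + 1) * (j ^ 2 + j)) * shiftAlpha m j =
      thetaTerm (m + 1 + l) (m + 1) j := by
  rw [thetaTerm, thetaTerm, show 2 * (m + 1 + l) + 2 - m = m + 2 * l + 4 by omega,
    show 2 * (m + 1 + l) + 2 - (m + 1) = m + 2 * l + 3 by omega]
  cases j with
  | zero => simp [shiftAlpha, lowerAlpha]; ring
  | succ j =>
    rw [shiftAlpha, lowerAlpha]
    simp only [choose_two_succ]
    have h := sq_eq_choose_two j
    set C := j.choose 2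
    have e1 : (l + 1) * ((j + 1) ^ 2 + (j + 1)) +
        ((m + 1) * ((j + 1) ^ 2 + 2 * (j + 1)) + (C + j) + m) + (j + 2) =
        ((2 * (m + 1 + l) + 3) * (C + j) + (m + 2 * l + 4) * (j + 1)) +
          (m + 1) * (2 * (j + 1) + 1) := by
      zify at h ⊢
      linear_combination (l + m + 2 : ℤ) * h
    have e2 : (l + 1) * ((j + 1) ^ 2 + (j + 1)) +
        ((m + 1) * (j ^ 2 + 2 * j) + C + m) + (j + 1) =
        (2 * (m + 1 + l) + 3) * (C + j) + (m + 2 * l + 3) * (j + 1) := by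
      zify at h ⊢
      linear_combination (l + m + 2 : ℤ) * h
    have e3 : (l + 1) * ((j + 1) ^ 2 + (j + 1)) +
        ((m + 1) * ((j + 1) ^ 2 + 2 * (j + 1)) + (C + j) + m) + (j + 2) + (j + 2) =
        ((2 * (m + 1 + l) + 3) * (C + j) + (m + 2 * l + 3) * (j + 1)) +
          (m + 1 + 1) * (2 * (j + 1) + 1) := by
      zify at h ⊢
      linear_combination (l + m + 2 : ℤ) * h
    have e4 : (l + 1) * ((j + 1) ^ 2 + (j + 1)) +
        ((m + 1) * (j ^ 2 + 2 * j) + C + m) + (j + 1) + (j + 1) =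
        (2 * (m + 1 + l) + 3) * (C + j) + (m + 2 * l + 4) * (j + 1) := by
      zify at h ⊢
      linear_combination (l + m + 2 : ℤ) * h
    have f1 := congrArg (fun n => (X : ℚ⟦X⟧) ^ n) e1
    have f2 := congrArg (fun n => (X : ℚ⟦X⟧) ^ n) e2
    have f3 := congrArg (fun n => (X : ℚ⟦X⟧) ^ n) e3
    have f4 := congrArg (fun n => (X : ℚ⟦X⟧) ^ n) e4
    simp only [pow_add _ ((2 * (m + 1 + l) + 3) * (C + j) + (m + 2 * l + 4) * (j + 1)),
      pow_add _ ((2 * (m + 1 + l) + 3) * (C + j) + (m + 2 * l + 3) * (j + 1))] at f1 f3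
    rw [pow_add _ _ (j + 2), pow_add _ ((l + 1) * ((j + 1) ^ 2 + (j + 1)))] at f1
    rw [pow_add _ _ (j + 1), pow_add _ ((l + 1) * ((j + 1) ^ 2 + (j + 1)))] at f2
    rw [pow_add _ _ (j + 2), pow_add _ _ (j + 2),
      pow_add _ ((l + 1) * ((j + 1) ^ 2 + (j + 1)))] at f3
    rw [pow_add _ _ (j + 1), pow_add _ _ (j + 1),
      pow_add _ ((l + 1) * ((j + 1) ^ 2 + (j + 1)))] at f4
    linear_combination (-1) ^ (j + 1) * (f1 - f3 + f2 - f4)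

lemma unitAlphaOne_eq_thetaTerm (k j : ℕ) :
    X ^ ((k + 1) * (j ^ 2 + 1 * j)) * unitAlphaOne j = thetaTerm k 0 j := by
  rw [unitAlphaOne, thetaTerm,
    show (2 * k + 3) * j.choose 2 + (2 * k + 2 - 0) * j =
      (k + 1) * (j ^ 2 + 1 * j) + j.choose 2 by rw [sq_eq_choose_two, Nat.sub_zero]; ring,
    pow_add]
  ring

lemma chainSum_add_sum_chainSum {k m : ℕ} (hm : m ≤ k) (N : ℕ) :
    chainSum k (fun _ => 1) N + ∑ i ∈ Finset.range m,
      X ^ (i + 1) * chainSum k (fun l => if l < k - 1 - i then 1 else 2) N =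
      baileyBeta 1 (thetaTerm k m) N := by
  induction m with
  | zero =>
    rw [chainSum_const baileyBeta_unitAlphaOne]
    simpa using baileyBeta_congr (unitAlphaOne_eq_thetaTerm k)
  | succ m ih =>
    obtain ⟨l, rfl⟩ := Nat.exists_eq_add_of_le hm
    rw [Finset.sum_range_succ, ← add_assoc, ih (by omega),
      show m + 1 + l - 1 - m = l by omega]
    have h := chainSum_ite l m N
    rw [show l + 1 + m = m + 1 + l by omega] at h
    rw [h, ← baileyBeta_congr (thetaTerm_succ m l), baileyBeta, baileyBeta, baileyBeta,
      ← Finset.sum_add_distrib]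
    exact Finset.sum_congr rfl fun j _ => by ring

/-- Prepend a value to a sequence. -/
def consSeq (t : ℕ) (g : ℕ → ℕ) : ℕ → ℕ
  | 0 => t
  | i + 1 => g i

open Classical in
/-- The weakly decreasing sequences bounded by `N` and vanishing from index `r` on. -/
def decSeqs : ℕ → ℕ → Finset (ℕ → ℕ)
  | 0, _ => {fun _ => 0}
  | r + 1, N => (Finset.range (N + 1)).biUnion fun t => (decSeqs r t).image (consSeq t)

lemma consSeq_injective (t : ℕ) : Function.Injective (consSeq t) := fun _ _ h =>
  funext fun i => congrFun h (i + 1)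

lemma mem_decSeqs {r N : ℕ} {f : ℕ → ℕ} :
    f ∈ decSeqs r N ↔
      ((∀ ⦃i j : ℕ⦄, i ≤ j → f j ≤ f i) ∧ ∀ i, r ≤ i → f i = 0) ∧ f 0 ≤ N := by
  classical
  induction r generalizing N f with
  | zero =>
    rw [decSeqs, Finset.mem_singleton]
    constructor
    · rintro rfl; simp
    · rintro ⟨⟨-, h⟩, -⟩
      exact funext fun i => h i (Nat.zero_le i)
  | succ r ih =>
    rw [decSeqs]
    simp only [Finset.mem_biUnion, Finset.mem_image, Finset.mem_range, ih]
    constructor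
    · rintro ⟨t, ht, g, ⟨⟨hg1, hg2⟩, hg3⟩, rfl⟩
      refine ⟨⟨fun i j hij => ?_, fun i hi => ?_⟩, Nat.lt_succ_iff.mp ht⟩
      · rcases i with _ | i <;> rcases j with _ | j
        · exact le_rfl
        · exact (hg1 (Nat.zero_le j)).trans hg3
        · omega
        · exact hg1 (by omega)
      · rcases i with _ | i
        · omega
        · exact hg2 i (by omega)
    · rintro ⟨⟨h1, h2⟩, h3⟩
      refine ⟨f 0, Nat.lt_succ_iff.mpr h3, fun i => f (i + 1),
        ⟨⟨fun i j hij => h1 (by omega), fun i hi => h2 _ (by omega)⟩, h1 (by omega)⟩, ?_⟩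
      funext i
      cases i <;> rfl

lemma sum_decSeqs (r : ℕ) (b : ℕ → ℕ) (N : ℕ) :
    ∑ f ∈ decSeqs r N, X ^ (∑ i ∈ Finset.range r, (f i ^ 2 + b i * f i)) *
      (invQ X (N - f 0) * ∏ i ∈ Finset.range r, invQ X (f i - f (i + 1))) =
      chainSum r b N := by
  classical
  induction r generalizing b N with
  | zero => simp [decSeqs, chainSum]
  | succ r ih =>
    rw [decSeqs, chainSum, Finset.sum_biUnion]
    · refine Finset.sum_congr rfl fun t _ => ?_
      rw [Finset.sum_image (consSeq_injective t).injOn, ← ih, Finset.mul_sum]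
      refine Finset.sum_congr rfl fun g _ => ?_
      rw [Finset.sum_range_succ', Finset.prod_range_succ']
      simp only [consSeq, pow_add]
      ring
    · intro t _ t' _ htt'
      refine Finset.disjoint_left.mpr fun f hf hf' => htt' ?_
      obtain ⟨g, -, rfl⟩ := Finset.mem_image.mp hf
      obtain ⟨g', -, h⟩ := Finset.mem_image.mp hf'
      exact (congrFun h 0).symm

lemma inv_qpT (r : ℕ) (f : ℕ → ℕ) :
    (qpT r f)⁻¹ = ∏ i ∈ Finset.range r, invQ X (f i - f (i + 1)) := by
  induction r with
  | zero => simp [qpT]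
  | succ r ih =>
    rw [Finset.prod_range_succ, ← ih, qpT, Finset.prod_range_succ, PowerSeries.mul_inv_rev,
      mul_comm]
    rfl

/-- The summand of the multisum. -/
def multisumTerm (k m : ℕ) (f : ℕ → ℕ) : ℚ⟦X⟧ :=
  X ^ (∑ i ∈ Finset.range k, (f i ^ 2 + f i)) * (qpT k f)⁻¹ *
    (1 + ∑ i ∈ Finset.range m, X ^ ∑ j ∈ Finset.range (i + 1), (f (k - 1 - j) + 1))

lemma sum_add_sum_tail {k i : ℕ} (hi : i < k) (f : ℕ → ℕ) :
    ∑ l ∈ Finset.range k, (f l ^ 2 + f l) +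
      ∑ j ∈ Finset.range (i + 1), (f (k - 1 - j) + 1) =
      (i + 1) +
        ∑ l ∈ Finset.range k, (f l ^ 2 + (if l < k - 1 - i then 1 else 2) * f l) := by
  obtain ⟨p, rfl⟩ := Nat.exists_eq_add_of_le' (Nat.succ_le_of_lt hi)
  have h1 : ∑ j ∈ Finset.range (i + 1), f (p + (i + 1) - 1 - j) =
      ∑ j ∈ Finset.range (i + 1), f (p + j) := by
    rw [← Finset.sum_range_reflect]
    refine Finset.sum_congr rfl fun j hj => ?_
    have := Finset.mem_range.mp hj
    congr 1
    omega
  have h2 : ∑ l ∈ Finset.range p, (f l ^ 2 + (if l < p then 1 else 2) * f l) =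
      ∑ l ∈ Finset.range p, (f l ^ 2 + f l) :=
    Finset.sum_congr rfl fun l hl => by rw [if_pos (Finset.mem_range.mp hl), one_mul]
  rw [Nat.succ_eq_add_one, show p + (i + 1) - 1 - i = p by omega,
    Finset.sum_range_add (fun l => f l ^ 2 + f l) p (i + 1),
    Finset.sum_range_add (fun l => f l ^ 2 + (if l < p then 1 else 2) * f l) p (i + 1), h2, Finset.sum_add_distrib (g := fun _ => 1), h1]
  simp only [Nat.not_lt.mpr (Nat.le_add_right p _), if_false, Finset.sum_const, Finset.card_range,
    Finset.sum_add_distrib, ← Finset.mul_sum, smul_eq_mul, mul_one]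
  ring

lemma sum_multisumTerm_mul_invQ {k m : ℕ} (hm : m ≤ k) (N : ℕ) :
    ∑ f ∈ decSeqs k N, multisumTerm k m f * invQ X (N - f 0) =
      baileyBeta 1 (thetaTerm k m) N := by
  rw [← chainSum_add_sum_chainSum hm]
  simp only [← sum_decSeqs, Finset.mul_sum]
  rw [Finset.sum_comm, ← Finset.sum_add_distrib]
  refine Finset.sum_congr rfl fun f _ => ?_
  rw [multisumTerm, inv_qpT, mul_add, mul_one, Finset.mul_sum, add_mul, Finset.sum_mul]
  congr 1
  · simp only [one_mul]; ring
  · refine Finset.sum_congr rfl fun i hi => ?_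
    have h := congrArg (fun n => (X : ℚ⟦X⟧) ^ n)
      (sum_add_sum_tail ((Finset.mem_range.mp hi).trans_le hm) f)
    simp only [pow_add _ (∑ l ∈ Finset.range k, (f l ^ 2 + f l)), pow_add _ (i + 1)] at h
    linear_combination
      (∏ i ∈ Finset.range k, invQ X (f i - f (i + 1))) * invQ X (N - f 0) * h

/-- Rothe's `q`-binomial theorem, in homogeneous form. -/
lemma prod_sub_mul_invQ {Q : ℚ⟦X⟧} (hQ : constantCoeff Q = 0) (a b : ℚ⟦X⟧) (n : ℕ) :
    (∏ i ∈ Finset.range n, (a - b * Q ^ i)) * invQ Q n =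
      ∑ p ∈ Finset.HasAntidiagonal.antidiagonal n,
        (-1) ^ p.1 * Q ^ p.1.choose 2 * b ^ p.1 * a ^ p.2 * (invQ Q p.1 * invQ Q p.2) := by
  induction n with
  | zero => simp [invQ_zero]
  | succ n ih =>
    apply mul_left_cancel₀ (one_sub_pow_ne_zero hQ n)
    have key : ∀ p ∈ Finset.HasAntidiagonal.antidiagonal (n + 1),
        (1 - Q ^ (n + 1)) *
          ((-1) ^ p.1 * Q ^ p.1.choose 2 * b ^ p.1 * a ^ p.2 * (invQ Q p.1 * invQ Q p.2)) =
        (-1) ^ p.1 * Q ^ p.1.choose 2 * b ^ p.1 * a ^ p.2 *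
          (invQ Q p.1 * ((1 - Q ^ p.2) * invQ Q p.2)) +
        (-1) ^ p.1 * Q ^ (p.1.choose 2 + p.2) * b ^ p.1 * a ^ p.2 *
          (((1 - Q ^ p.1) * invQ Q p.1) * invQ Q p.2) := by
      intro p hp
      rw [← Finset.HasAntidiagonal.mem_antidiagonal.mp hp, pow_add, pow_add]
      ring
    rw [Finset.mul_sum, Finset.sum_congr rfl key, Finset.sum_add_distrib,
      Finset.Nat.sum_antidiagonal_succ', Finset.Nat.sum_antidiagonal_succ]
    simp only [one_sub_mul_invQ hQ, pow_zero, sub_self, zero_mul, mul_zero, zero_add]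
    have h1 : ∀ p ∈ Finset.HasAntidiagonal.antidiagonal n,
        (-1) ^ (p.1 + 1) * Q ^ ((p.1 + 1).choose 2 + p.2) * b ^ (p.1 + 1) * a ^ p.2 *
          (invQ Q p.1 * invQ Q p.2) =
        (-(b * Q ^ n)) * ((-1) ^ p.1 * Q ^ p.1.choose 2 * b ^ p.1 * a ^ p.2 *
          (invQ Q p.1 * invQ Q p.2)) := by
      intro p hp
      rw [← Finset.HasAntidiagonal.mem_antidiagonal.mp hp, choose_two_succ]
      ring
    have h2 : ∀ p ∈ Finset.HasAntidiagonal.antidiagonal n,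
        (-1) ^ p.1 * Q ^ p.1.choose 2 * b ^ p.1 * a ^ (p.2 + 1) * (invQ Q p.1 * invQ Q p.2) =
        a * ((-1) ^ p.1 * Q ^ p.1.choose 2 * b ^ p.1 * a ^ p.2 *
          (invQ Q p.1 * invQ Q p.2)) := by
      intro p _
      ring
    rw [Finset.sum_congr rfl h1, Finset.sum_congr rfl h2, ← Finset.mul_sum, ← Finset.mul_sum,
      ← ih, Finset.prod_range_succ]
    linear_combination
      (∏ i ∈ Finset.range n, (a - b * Q ^ i)) * (a - b * Q ^ n) * one_sub_mul_invQ hQ n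

lemma choose_two_add (a b : ℕ) : (a + b).choose 2 = a.choose 2 + b.choose 2 + a * b := by
  have h1 := sq_eq_choose_two a
  have h2 := sq_eq_choose_two b
  have h3 := sq_eq_choose_two (a + b)
  nlinarith

lemma prod_X_pow_add_mul (c M S : ℕ) :
    ∏ i ∈ Finset.range S, (X : ℚ⟦X⟧) ^ (c + M * i) = X ^ (c * S + M * S.choose 2) := by
  induction S with
  | zero => simp
  | succ S ih =>
    rw [Finset.prod_range_succ, ih, ← pow_add, choose_two_succ]
    congr 1
    ring

/-- A finite form of the Jacobi triple product identity. -/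
lemma sum_triple_product (c d : ℕ) (hd : 0 < d) (S : ℕ) :
    ∑ j ∈ Finset.range (S + 1),
      (-1) ^ j * X ^ ((c + d) * j.choose 2 + d * j) * (1 - X ^ (c * (2 * j + 1))) *
        (invQ (X ^ (c + d)) (S - j) * invQ (X ^ (c + d)) (S + j + 1)) =
      (∏ i ∈ Finset.range (S + 1), (1 - X ^ ((c + d) * i + c))) *
        (∏ i ∈ Finset.range S, (1 - X ^ ((c + d) * i + d))) *
        invQ (X ^ (c + d)) (2 * S + 1) := by
  obtain ⟨M, hM⟩ : ∃ M, M = c + d := ⟨_, rfl⟩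
  rw [← hM]
  have hQ : constantCoeff ((X : ℚ⟦X⟧) ^ M) = 0 := by simp; omega
  have key := prod_sub_mul_invQ hQ ((X ^ M) ^ S) (X ^ c) (S + 1 + S)
  have hne : ((-1) ^ S * X ^ (c * S + M * S.choose 2 + M * S * (S + 1)) : ℚ⟦X⟧) ≠ 0 :=
    mul_ne_zero (pow_ne_zero _ (by simp)) (pow_ne_zero _ PowerSeries.X_ne_zero)
  apply mul_left_cancel₀ hne
  have hL : ∏ i ∈ Finset.range (S + 1 + S), ((X ^ M) ^ S - X ^ c * (X ^ M) ^ i : ℚ⟦X⟧) =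
      (-1) ^ S * X ^ (c * S + M * S.choose 2 + M * S * (S + 1)) *
      ((∏ i ∈ Finset.range (S + 1), (1 - X ^ (M * i + c))) *
        ∏ i ∈ Finset.range S, (1 - X ^ (M * i + d))) := by
    rw [show S + 1 + S = S + (S + 1) by ring, Finset.prod_range_add]
    have h1 : ∏ i ∈ Finset.range S, ((X ^ M) ^ S - X ^ c * (X ^ M) ^ i : ℚ⟦X⟧) =
        (-1) ^ S * X ^ (c * S + M * S.choose 2) *
          ∏ i ∈ Finset.range S, (1 - X ^ (M * i + d)) := by
      rw [← Finset.prod_range_reflect (fun i => (1 - X ^ (M * i + d) : ℚ⟦X⟧)),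
        ← prod_X_pow_add_mul,
        show (-1 : ℚ⟦X⟧) ^ S = ∏ _i ∈ Finset.range S, (-1 : ℚ⟦X⟧) by
          rw [Finset.prod_const, Finset.card_range],
        ← Finset.prod_mul_distrib, ← Finset.prod_mul_distrib]
      refine Finset.prod_congr rfl fun i hi => ?_
      obtain ⟨l, rfl⟩ := Nat.exists_eq_add_of_lt (Finset.mem_range.mp hi)
      rw [show i + l + 1 - 1 - i = l by omega, ← pow_mul, ← pow_mul, ← pow_add,
        show M * (i + l + 1) = (c + M * i) + (M * l + d) by rw [hM]; ring, pow_add _ (c + M * i)]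
      ring
    have h2 : ∏ i ∈ Finset.range (S + 1), ((X ^ M) ^ S - X ^ c * (X ^ M) ^ (S + i) : ℚ⟦X⟧) =
        X ^ (M * S * (S + 1)) * ∏ i ∈ Finset.range (S + 1), (1 - X ^ (M * i + c)) := by
      rw [pow_mul X (M * S), ← Finset.card_range (S + 1), ← Finset.prod_const,
        Finset.card_range, ← Finset.prod_mul_distrib]
      refine Finset.prod_congr rfl fun i _ => ?_
      ring
    rw [h1, h2, pow_add _ (c * S + M * S.choose 2)]
    ring
  rw [hL] at key
  rw [show 2 * S + 1 = S + 1 + S by ring, ← mul_assoc, key,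
    Finset.Nat.sum_antidiagonal_eq_sum_range_succ (fun i l =>
      (-1) ^ i * (X ^ M) ^ i.choose 2 * (X ^ c) ^ i * (((X : ℚ⟦X⟧) ^ M) ^ S) ^ l *
        (invQ (X ^ M) i * invQ (X ^ M) l)),
    show (S + 1 + S).succ = S + 1 + (S + 1) by omega, Finset.sum_range_add _ (S + 1) (S + 1)]
  conv_rhs => rw [← Finset.sum_range_reflect, ← Finset.sum_add_distrib]
  rw [Finset.mul_sum]
  refine Finset.sum_congr rfl fun j hj => ?_
  obtain ⟨l, rfl⟩ := Nat.exists_eq_add_of_le (Nat.lt_succ_iff.mp (Finset.mem_range.mp hj))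
  rw [show j + l + 1 - 1 - j = l by omega, show j + l + 1 + (j + l) - l = j + l + j + 1 by omega,
    show j + l + 1 + (j + l) - (j + l + 1 + j) = l by omega, show j + l - j = l by omega,
    show j + l + 1 + j = j + l + j + 1 by omega]
  have hsq := sq_eq_choose_two j
  have h1 : c * (j + l) + M * (j + l).choose 2 + M * (j + l) * (j + l + 1) +
      (M * j.choose 2 + d * j) = M * l.choose 2 + c * l + M * (j + l) * (j + l + j + 1) := by
    rw [choose_two_add, hM]
    linear_combination (c + d) * hsq.symm
  have h2 : c * (j + l) + M * (j + l).choose 2 + M * (j + l) * (j + l + 1) +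
      (M * j.choose 2 + d * j) + c * (2 * j + 1) =
      M * (j + l + j + 1).choose 2 + c * (j + l + j + 1) + M * (j + l) * l := by
    rw [choose_two_succ, choose_two_add (j + l) j, hM]
    ring
  have h1' := congrArg (fun n => (X : ℚ⟦X⟧) ^ n) h1
  have h2' := congrArg (fun n => (X : ℚ⟦X⟧) ^ n) h2
  have h3 : ((-1) ^ j * (-1) ^ j : ℚ⟦X⟧) = 1 := by rw [← mul_pow]; simp
  simp only [← pow_mul]
  simp only [pow_add _ (c * (j + l) + M * (j + l).choose 2 + M * (j + l) * (j + l + 1)),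
    pow_add _ (c * (j + l) + M * (j + l).choose 2 + M * (j + l) * (j + l + 1) +
      (M * j.choose 2 + d * j)), pow_add _ (M * l.choose 2 + c * l),
    pow_add _ (M * (j + l + j + 1).choose 2 + c * (j + l + j + 1)),
    pow_add _ (M * l.choose 2), pow_add _ (M * (j + l + j + 1).choose 2)] at h1' h2' ⊢
  simp only [pow_add (-1 : ℚ⟦X⟧), pow_one]
  generalize (X : ℚ⟦X⟧) ^ (c * (j + l) + M * (j + l).choose 2 + M * (j + l) * (j + l + 1)) = E
    at h1' h2' ⊢
  generalize (X : ℚ⟦X⟧) ^ (M * j.choose 2 + d * j) = F at h1' h2' ⊢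
  generalize (-1 : ℚ⟦X⟧) ^ j = s at h3 ⊢
  generalize (-1 : ℚ⟦X⟧) ^ l = t
  generalize invQ (X ^ M) l = I
  generalize invQ (X ^ M) (j + l + j + 1) = J
  linear_combination (s * s * t * I * J) * h1' - (s * s * t * I * J) * h2' +
    (t * I * J * X ^ (M * l.choose 2) * X ^ (c * l) * X ^ (M * (j + l) * (j + l + j + 1))) * h3

lemma dvd_prod_sub_one {ι R : Type*} [CommRing R] (s : Finset ι) (f : ι → R) (d : R)
    (h : ∀ i ∈ s, d ∣ f i - 1) : d ∣ ∏ i ∈ s, f i - 1 :=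
  Finset.prod_induction f (fun x => d ∣ x - 1)
    (fun a b ha hb => by
      rw [show a * b - 1 = a * (b - 1) + (a - 1) by ring]
      exact dvd_add (dvd_mul_of_dvd_right hb a) ha)
    (by simp) h

lemma X_pow_dvd_pow {Q : ℚ⟦X⟧} (hQ : constantCoeff Q = 0) {n l : ℕ} (h : n ≤ l) :
    X ^ n ∣ Q ^ l :=
  (pow_dvd_pow X h).trans (pow_dvd_pow_of_dvd (PowerSeries.X_dvd_iff.mpr hQ) l)

lemma X_pow_dvd_prod_tail_sub_one {Q : ℚ⟦X⟧} (hQ : constantCoeff Q = 0) (n l : ℕ) :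
    X ^ n ∣ ∏ i ∈ Finset.range l, (1 - Q ^ (n + i + 1)) - 1 := by
  refine dvd_prod_sub_one _ _ _ fun i _ => ?_
  rw [show 1 - Q ^ (n + i + 1) - 1 = -Q ^ (n + i + 1) by ring, dvd_neg]
  exact X_pow_dvd_pow hQ (by omega)

lemma X_pow_dvd_prod_mul_invQ_sub_one {Q : ℚ⟦X⟧} (hQ : constantCoeff Q = 0) {n n' : ℕ}
    (h : n ≤ n') :
    X ^ n ∣ (∏ i ∈ Finset.range n', (1 - Q ^ (i + 1))) * invQ Q n - 1 := by
  obtain ⟨l, rfl⟩ := Nat.exists_eq_add_of_le h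
  rw [Finset.prod_range_add, mul_right_comm, prod_mul_invQ hQ, one_mul]
  exact X_pow_dvd_prod_tail_sub_one hQ n l

lemma X_pow_dvd_prod_mul_invQ_sub_one' {Q : ℚ⟦X⟧} (hQ : constantCoeff Q = 0) {n n' : ℕ}
    (h : n ≤ n') :
    X ^ n ∣ (∏ i ∈ Finset.range n, (1 - Q ^ (i + 1))) * invQ Q n' - 1 := by
  obtain ⟨l, rfl⟩ := Nat.exists_eq_add_of_le h
  have h1 := prod_mul_invQ hQ (n + l)
  rw [Finset.prod_range_add] at h1
  have h2 := (X_pow_dvd_prod_tail_sub_one hQ n l).mul_left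
    (-((∏ i ∈ Finset.range n, (1 - Q ^ (i + 1))) * invQ Q (n + l)))
  convert h2 using 1
  linear_combination h1

lemma X_pow_dvd_sum_sub_sum {Q : ℚ⟦X⟧} (hQ : constantCoeff Q = 0) (G : ℕ → ℚ⟦X⟧)
    (hG : ∀ j, X ^ j ∣ G j) (N : ℕ) :
    X ^ N ∣ (∏ i ∈ Finset.range N, (1 - Q ^ (i + 1))) ^ 2 *
        ∑ j ∈ Finset.range (N + 1), G j * (invQ Q (N - j) * invQ Q (N + j + 1)) -
      ∑ j ∈ Finset.range (N + 1), G j := by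
  rw [Finset.mul_sum, ← Finset.sum_sub_distrib]
  refine Finset.dvd_sum fun j hj => ?_
  obtain ⟨l, rfl⟩ := Nat.exists_eq_add_of_le (Nat.lt_succ_iff.mp (Finset.mem_range.mp hj))
  rw [Nat.add_sub_cancel_left]
  have h1 := X_pow_dvd_prod_mul_invQ_sub_one hQ (Nat.le_add_left l j)
  have h2 := (pow_dvd_pow X (Nat.le_add_left l j)).trans
    (X_pow_dvd_prod_mul_invQ_sub_one' hQ (show j + l ≤ j + l + j + 1 by omega))
  have h3 := mul_dvd_mul (hG j) (dvd_add
    (h1.mul_right ((∏ i ∈ Finset.range (j + l), (1 - Q ^ (i + 1))) * invQ Q (j + l + j + 1))) h2)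
  rw [← pow_add] at h3
  convert h3 using 1
  ring

lemma X_pow_dvd_thetaTerm {k m : ℕ} (hm : m ≤ k) (j : ℕ) : X ^ j ∣ thetaTerm k m j := by
  rw [thetaTerm]
  refine Dvd.dvd.mul_right (Dvd.dvd.mul_left (pow_dvd_pow X ?_) _) _
  have : 1 ≤ 2 * k + 2 - m := by omega
  nlinarith [Nat.zero_le ((2 * k + 3) * j.choose 2)]

lemma X_pow_dvd_multisumTerm {k : ℕ} (hk : 1 ≤ k) (m : ℕ) (f : ℕ → ℕ) :
    X ^ f 0 ∣ multisumTerm k m f := by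
  rw [multisumTerm, mul_assoc]
  refine Dvd.dvd.mul_right (pow_dvd_pow X ?_) _
  have h := Finset.single_le_sum (f := fun i => f i ^ 2 + f i) (fun _ _ => Nat.zero_le _)
    (Finset.mem_range.mpr (Nat.lt_of_succ_le hk))
  exact (Nat.le_add_left _ _).trans h

lemma X_pow_dvd_sum_multisumTerm {k m : ℕ} (hk : 1 ≤ k) (hm : m ≤ k) (N : ℕ) :
    X ^ N ∣ (∏ i ∈ Finset.range N, (1 - X ^ (i + 1))) * baileyBeta 1 (thetaTerm k m) N -
      ∑ f ∈ decSeqs k N, multisumTerm k m f := by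
  rw [← sum_multisumTerm_mul_invQ hm, Finset.mul_sum, ← Finset.sum_sub_distrib]
  refine Finset.dvd_sum fun f hf => ?_
  obtain ⟨l, hl⟩ := Nat.exists_eq_add_of_le (mem_decSeqs.mp hf).2
  have h := mul_dvd_mul (X_pow_dvd_multisumTerm hk m f)
    (X_pow_dvd_prod_mul_invQ_sub_one PowerSeries.constantCoeff_X (Nat.le_add_left l (f 0)))
  rw [← pow_add, ← hl] at h
  rw [show N - f 0 = l by omega]
  convert h using 1
  ring

lemma X_pow_dvd_prod_mul_sum_sub {k m : ℕ} (hk : 1 ≤ k) (hm : m ≤ k) (N : ℕ) :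
    X ^ N ∣ (∏ i ∈ Finset.range N, (1 - X ^ (i + 1))) * ∑ f ∈ decSeqs k N, multisumTerm k m f -
      (∏ i ∈ Finset.range N, (1 - X ^ ((2 * k + 3) * i + (m + 1)))) *
        (∏ i ∈ Finset.range N, (1 - X ^ ((2 * k + 3) * i + (2 * k + 2 - m)))) *
        ∏ i ∈ Finset.range N, (1 - X ^ ((2 * k + 3) * (i + 1))) := by
  have hM : m + 1 + (2 * k + 2 - m) = 2 * k + 3 := by omega
  have hQ : constantCoeff ((X : ℚ⟦X⟧) ^ (2 * k + 3)) = 0 := by simp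
  have h1 := (X_pow_dvd_sum_multisumTerm hk hm N).mul_left
    (∏ i ∈ Finset.range N, (1 - X ^ (i + 1)))
  have h2 := X_pow_dvd_sum_sub_sum PowerSeries.constantCoeff_X _ (X_pow_dvd_thetaTerm hm) N
  have h3 := X_pow_dvd_sum_sub_sum hQ _ (X_pow_dvd_thetaTerm hm) N
  have h4 := sum_triple_product (m + 1) (2 * k + 2 - m) (by omega) N
  rw [hM] at h4
  have h5 : baileyBeta 1 (thetaTerm k m) N = ∑ j ∈ Finset.range (N + 1),
      thetaTerm k m j * (invQ X (N - j) * invQ X (N + j + 1)) :=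
    Finset.sum_congr rfl fun j hj => by
      rw [kernel, if_pos (Nat.lt_succ_iff.mp (Finset.mem_range.mp hj))]
  have h6 := X_pow_dvd_prod_mul_invQ_sub_one' hQ (show N ≤ 2 * N + 1 by omega)
  have h7 : (X : ℚ⟦X⟧) ^ N ∣ X ^ ((2 * k + 3) * N + (m + 1)) := pow_dvd_pow X (by nlinarith)
  have h8 : ∑ j ∈ Finset.range (N + 1), thetaTerm k m j *
      (invQ (X ^ (2 * k + 3)) (N - j) * invQ (X ^ (2 * k + 3)) (N + j + 1)) = _ := h4
  rw [h8, Finset.prod_range_succ] at h3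
  rw [h5] at h1
  simp only [pow_mul X (2 * k + 3) (_ + 1)]
  obtain ⟨w1, e1⟩ := h1
  obtain ⟨w2, e2⟩ := h2
  obtain ⟨w3, e3⟩ := h3
  obtain ⟨w6, e6⟩ := h6
  obtain ⟨w7, e7⟩ := h7
  generalize (X : ℚ⟦X⟧) ^ ((2 * k + 3) * N + (m + 1)) = a at *
  generalize ∏ i ∈ Finset.range N, (1 - (X : ℚ⟦X⟧) ^ ((2 * k + 3) * i + (m + 1))) = A at *
  generalize ∏ i ∈ Finset.range N, (1 - (X : ℚ⟦X⟧) ^ ((2 * k + 3) * i + (2 * k + 2 - m))) = B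
    at *
  generalize ∏ i ∈ Finset.range N, (1 - ((X : ℚ⟦X⟧) ^ (2 * k + 3)) ^ (i + 1)) = P at *
  refine ⟨-w1 + w2 - w3 + P * A * B * (1 - a) * w6 - P * A * B * w7, ?_⟩
  linear_combination -e1 + e2 - e3 + P * A * B * (1 - a) * e6 - P * A * B * e7

/-- The residue condition on the factors of the product side. -/
def GoodResidue (k m n : ℕ) : Prop :=
  ((n + 1 : ℕ) : ZMod (2 * k + 3)) ≠ 0 ∧
    ((n + 1 : ℕ) : ZMod (2 * k + 3)) ≠ ((m + 1 : ℕ) : ZMod (2 * k + 3)) ∧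
    ((n + 1 : ℕ) : ZMod (2 * k + 3)) ≠ -((m + 1 : ℕ) : ZMod (2 * k + 3))

instance (k m n : ℕ) : Decidable (GoodResidue k m n) :=
  inferInstanceAs (Decidable (_ ∧ _))

lemma not_goodResidue_iff {k m r : ℕ} (hm : m ≤ k) (hr : r < 2 * k + 3) (i : ℕ) :
    ¬ GoodResidue k m ((2 * k + 3) * i + r) ↔ r = m ∨ r = 2 * k + 1 - m ∨ r = 2 * k + 2 := by
  have hcast : (((2 * k + 3) * i + r + 1 : ℕ) : ZMod (2 * k + 3)) = ((r + 1 : ℕ) : ZMod _) := by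
    rw [add_assoc, Nat.cast_add, Nat.cast_mul, ZMod.natCast_self, zero_mul, zero_add]
  have h0 : ((r + 1 : ℕ) : ZMod (2 * k + 3)) = 0 ↔ r = 2 * k + 2 := by
    rw [ZMod.natCast_eq_zero_iff]
    constructor
    · intro h
      have := Nat.le_of_dvd (Nat.succ_pos r) h
      omega
    · rintro rfl
      exact dvd_rfl
  have h1 : ((r + 1 : ℕ) : ZMod (2 * k + 3)) = ((m + 1 : ℕ) : ZMod (2 * k + 3)) ↔ r = m := by
    constructor
    · intro h
      have h' : ((r : ℕ) : ZMod (2 * k + 3)) = ((m : ℕ) : ZMod (2 * k + 3)) := by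
        push_cast at h
        exact add_right_cancel h
      rw [ZMod.natCast_eq_natCast_iff', Nat.mod_eq_of_lt hr, Nat.mod_eq_of_lt (by omega)] at h'
      exact h'
    · rintro rfl
      rfl
  have h2 : ((r + 1 : ℕ) : ZMod (2 * k + 3)) = -((m + 1 : ℕ) : ZMod (2 * k + 3)) ↔
      r = 2 * k + 1 - m := by
    rw [eq_neg_iff_add_eq_zero, ← Nat.cast_add, ZMod.natCast_eq_zero_iff]
    constructor
    · rintro ⟨t, ht⟩
      have ht1 : t = 1 := by
        have : t ≠ 0 := by rintro rfl; omega
        have : t < 2 := by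
          by_contra hcon
          nlinarith
        omega
      subst ht1
      omega
    · intro h
      rw [show r + 1 + (m + 1) = 2 * k + 3 by omega]
  rw [GoodResidue, hcast, Ne, Ne, Ne, h0, h1, h2]
  tauto

/-- The factors of the product side. -/
def productFactor (k m n : ℕ) : ℚ⟦X⟧ :=
  if GoodResidue k m n then (1 - X ^ (n + 1))⁻¹ else 1

lemma one_sub_X_pow_mul_inv (n : ℕ) : (1 - X ^ (n + 1) : ℚ⟦X⟧) * (1 - X ^ (n + 1))⁻¹ = 1 :=
  PowerSeries.mul_inv_cancel _ (by simp)

lemma X_pow_dvd_productFactor_sub_one (k m : ℕ) {D n : ℕ} (h : D ≤ n) :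
    X ^ D ∣ productFactor k m n - 1 := by
  rw [productFactor]
  split_ifs
  · have h1 : (X : ℚ⟦X⟧) ^ D ∣ X ^ (n + 1) := pow_dvd_pow X (by omega)
    convert h1.mul_right (1 - X ^ (n + 1))⁻¹ using 1
    linear_combination one_sub_X_pow_mul_inv n
  · simp

lemma productFactor_mul_one_sub (k m n : ℕ) :
    productFactor k m n * (1 - X ^ (n + 1)) =
      if ¬ GoodResidue k m n then 1 - X ^ (n + 1) else 1 := by
  rw [productFactor, ite_not]
  split_ifs
  · rw [mul_comm, one_sub_X_pow_mul_inv]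
  · rw [one_mul]

lemma prod_period {k m : ℕ} (hm : m ≤ k) (i : ℕ) :
    ∏ r ∈ Finset.range (2 * k + 3), productFactor k m ((2 * k + 3) * i + r) *
        (1 - X ^ ((2 * k + 3) * i + r + 1)) =
      (1 - X ^ ((2 * k + 3) * i + (m + 1))) * (1 - X ^ ((2 * k + 3) * i + (2 * k + 2 - m))) *
        (1 - X ^ ((2 * k + 3) * (i + 1))) := by
  have h1 : ∀ r ∈ Finset.range (2 * k + 3), productFactor k m ((2 * k + 3) * i + r) *
      (1 - X ^ ((2 * k + 3) * i + r + 1)) =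
      if r ∈ ({m, 2 * k + 1 - m, 2 * k + 2} : Finset ℕ)
        then (1 - X ^ ((2 * k + 3) * i + r + 1) : ℚ⟦X⟧) else 1 := by
    intro r hr
    rw [productFactor_mul_one_sub]
    refine if_congr ?_ rfl rfl
    rw [not_goodResidue_iff hm (Finset.mem_range.mp hr)]
    simp
  rw [Finset.prod_congr rfl h1, Finset.prod_ite_mem, Finset.inter_eq_right.mpr,
    Finset.prod_insert, Finset.prod_insert, Finset.prod_singleton,
    show (2 * k + 3) * i + (2 * k + 1 - m) + 1 = (2 * k + 3) * i + (2 * k + 2 - m) by omega,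
    show (2 * k + 3) * i + (2 * k + 2) + 1 = (2 * k + 3) * (i + 1) by ring, add_assoc, mul_assoc]
  · simp; omega
  · simp; omega
  · intro r hr
    simp only [Finset.mem_insert, Finset.mem_singleton] at hr
    rw [Finset.mem_range]
    omega

lemma prod_productFactor_mul {k m : ℕ} (hm : m ≤ k) (N : ℕ) :
    (∏ n ∈ Finset.range ((2 * k + 3) * N), productFactor k m n) *
        ∏ n ∈ Finset.range ((2 * k + 3) * N), (1 - X ^ (n + 1)) =
      (∏ i ∈ Finset.range N, (1 - X ^ ((2 * k + 3) * i + (m + 1)))) *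
        (∏ i ∈ Finset.range N, (1 - X ^ ((2 * k + 3) * i + (2 * k + 2 - m)))) *
        ∏ i ∈ Finset.range N, (1 - X ^ ((2 * k + 3) * (i + 1))) := by
  rw [← Finset.prod_mul_distrib, ← Finset.prod_mul_distrib, ← Finset.prod_mul_distrib]
  induction N with
  | zero => simp
  | succ N ih =>
    rw [Nat.mul_succ, Finset.prod_range_add, ih, Finset.prod_range_succ _ N, prod_period hm]

lemma X_pow_dvd_sum_sub_prod {k m : ℕ} (hk : 1 ≤ k) (hm : m ≤ k) (N : ℕ) :
    X ^ N ∣ ∑ f ∈ decSeqs k N, multisumTerm k m f -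
      ∏ n ∈ Finset.range ((2 * k + 3) * N), productFactor k m n := by
  obtain ⟨w1, e1⟩ := X_pow_dvd_prod_mul_sum_sub hk hm N
  obtain ⟨w2, e2⟩ := X_pow_dvd_prod_mul_invQ_sub_one' (Q := X) PowerSeries.constantCoeff_X
    (show N ≤ (2 * k + 3) * N by nlinarith)
  have e3 := prod_productFactor_mul hm N
  have e4 := prod_mul_invQ (Q := X) PowerSeries.constantCoeff_X ((2 * k + 3) * N)
  refine ⟨invQ X ((2 * k + 3) * N) * w1 - (∑ f ∈ decSeqs k N, multisumTerm k m f) * w2, ?_⟩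
  linear_combination invQ X ((2 * k + 3) * N) * e1 -
    (∑ f ∈ decSeqs k N, multisumTerm k m f) * e2 - invQ X ((2 * k + 3) * N) * e3 +
    (∏ n ∈ Finset.range ((2 * k + 3) * N), productFactor k m n) * e4

lemma tendsto_of_X_pow_dvd_sub {ι : Type*} (F : Finset ι → ℚ⟦X⟧) (G : ℕ → ℚ⟦X⟧)
    (h : ∀ D, ∃ S, ∀ s, S ⊆ s → X ^ D ∣ F s - G D) :
    Filter.Tendsto F Filter.atTop (nhds (PowerSeries.mk fun d => coeff d (G (d + 1)))) := by
  refine (PowerSeries.WithPiTopology.tendsto_iff_coeff_tendsto (R := ℚ) F _ _).mpr fun d => ?_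
  obtain ⟨S, hS⟩ := h (d + 1)
  refine tendsto_const_nhds.congr' (Filter.eventually_atTop.mpr ⟨S, fun s hs => ?_⟩)
  have h1 := PowerSeries.X_pow_dvd_iff.mp (hS s hs) d (Nat.lt_succ_self d)
  rw [map_sub, sub_eq_zero] at h1
  rw [PowerSeries.coeff_mk]
  exact h1.symm

lemma hasProd_productFactor (k m : ℕ) :
    HasProd (productFactor k m) (PowerSeries.mk fun d => coeff d
      (∏ n ∈ Finset.range ((2 * k + 3) * (d + 1)), productFactor k m n)) := by
  rw [HasProd, SummationFilter.unconditional_filter]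
  refine tendsto_of_X_pow_dvd_sub _
    (fun D => ∏ n ∈ Finset.range ((2 * k + 3) * D), productFactor k m n) fun D =>
      ⟨Finset.range ((2 * k + 3) * D), fun s hs => ?_⟩
  rw [← Finset.prod_sdiff hs]
  have h := (dvd_prod_sub_one (s \ Finset.range ((2 * k + 3) * D)) (productFactor k m) (X ^ D)
    fun n hn => X_pow_dvd_productFactor_sub_one k m ?_).mul_right
      (∏ n ∈ Finset.range ((2 * k + 3) * D), productFactor k m n)
  · rwa [sub_mul, one_mul] at h
  · rw [Finset.mem_sdiff, Finset.mem_range] at hn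
    nlinarith [hn.2]

lemma hasSum_multisumTerm {k m : ℕ} (hk : 1 ≤ k) (hm : m ≤ k) :
    HasSum (fun f : {f : ℕ → ℕ // (∀ ⦃i j : ℕ⦄, i ≤ j → f j ≤ f i) ∧ ∀ i, k ≤ i → f i = 0} =>
      multisumTerm k m f.1) (PowerSeries.mk fun d => coeff d
      (∏ n ∈ Finset.range ((2 * k + 3) * (d + 1)), productFactor k m n)) := by
  classical
  rw [HasSum, SummationFilter.unconditional_filter]
  refine tendsto_of_X_pow_dvd_sub _
    (fun D => ∏ n ∈ Finset.range ((2 * k + 3) * D), productFactor k m n) fun D =>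
      ⟨(decSeqs k D).subtype _, fun s hs => ?_⟩
  rw [← Finset.sum_sdiff hs, Finset.sum_subtype_of_mem (multisumTerm k m)
    fun f hf => (mem_decSeqs.mp hf).1, add_sub_assoc]
  refine dvd_add (Finset.dvd_sum fun f hf => ?_) (X_pow_dvd_sum_sub_prod hk hm D)
  refine (pow_dvd_pow X ?_).trans (X_pow_dvd_multisumTerm hk m f.1)
  rw [Finset.mem_sdiff, Finset.mem_subtype, mem_decSeqs] at hf
  by_contra hcon
  exact hf.2 ⟨f.2, by omega⟩

/-- The Andrews–Gordon type identity  (`f.1 t` is `λ_{t+1}`). -/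
theorem stmt10 (k m : ℕ) (hk : 1 ≤ k) (hm : m ≤ k) :
    (∑' f : DecTuple k,
        (X : ℚ⟦X⟧) ^ (∑ i ∈ Finset.range k, (f.1 i ^ 2 + f.1 i)) * (qpT k f.1)⁻¹ *
          (1 + ∑ i ∈ Finset.range m,
            (X : ℚ⟦X⟧) ^ ∑ j ∈ Finset.range (i + 1), (f.1 (k - 1 - j) + 1))) =
      ∏' n : ℕ,
          if ((n + 1 : ℕ) : ZMod (2 * k + 3)) ≠ 0 ∧
              ((n + 1 : ℕ) : ZMod (2 * k + 3)) ≠ ((m + 1 : ℕ) : ZMod (2 * k + 3)) ∧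
              ((n + 1 : ℕ) : ZMod (2 * k + 3)) ≠ -((m + 1 : ℕ) : ZMod (2 * k + 3))
          then (1 - (X : ℚ⟦X⟧) ^ (n + 1))⁻¹ else 1 := by
  have : T2Space ℚ⟦X⟧ := inferInstanceAs (T2Space ((Unit →₀ ℕ) → ℚ))
  exact (hasSum_multisumTerm hk hm).tsum_eq.trans (hasProd_productFactor k m).tprod_eq.symm
end
end

section
/- Let k ≥ 1 and 1 ≤ s ≤ k, and let P ∈ ℤ[x_1, …, x_k, q] be any polynomial not involving the variable x_s. If s ≥ 2 then x_s (1 + q x_s x_{s+1}) P ≈₂ x_{s+1} (1 + q x_{s−1} x_s) P, and if s = 1 then x_1 (1 + x_2 + q x_1 x_2) P ≈₂ x_2 P; here by convention x_j = 0 for j < 1 and x_j = 1 for j > k. -/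
open PowerSeries

noncomputable section

/-- The variable `x_j` (1-indexed, `1 ≤ j ≤ r`) of `ℤ[x_1,…,x_r,q]`, with the
conventions `x_j = 0` for `j < 1` and `x_j = 1` for `j > r`. -/
def xv (r j : ℕ) : MvPolynomial (Fin (r + 1)) ℤ :=
  if h : 1 ≤ j ∧ j ≤ r then MvPolynomial.X ⟨j - 1, by omega⟩
  else if j = 0 then 0 else 1

/-- The variable `q` of `ℤ[x_1,…,x_r,q]`. -/
def qv (r : ℕ) : MvPolynomial (Fin (r + 1)) ℤ := MvPolynomial.X (Fin.last r)

/-- Evaluation of `P ∈ ℤ[x_1,…,x_r,q]` at `x_j = q^{λ_j}` and `q = X` in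
`ℚ⟦X⟧`; here `f` is the 0-indexed tuple `(λ_1, …, λ_r)`. -/
def pEval (r : ℕ) (f : ℕ → ℕ) (P : MvPolynomial (Fin (r + 1)) ℤ) : ℚ⟦X⟧ :=
  MvPolynomial.aeval
    (fun i : Fin (r + 1) => if (i : ℕ) < r then (X : ℚ⟦X⟧) ^ f i else X) P

/-- The relation `P ≈₂ Q`:
`Σ_{λ_1 ≥ … ≥ λ_k ≥ 0} (-q)_{λ_1} q^{λ_1(λ_1-1)/2 + Σ_{i=2}^k λ_i²}/(q)_λ ·
  (P(q^{λ_1},…,q^{λ_k},q) - Q(q^{λ_1},…,q^{λ_k},q)) = 0`. -/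
def papprox2 (k : ℕ) (P Q : MvPolynomial (Fin (k + 1)) ℤ) : Prop :=
  ∑' f : DecTuple k,
    nqp (f.1 0) *
        (X : ℚ⟦X⟧) ^ (f.1 0 * (f.1 0 - 1) / 2 + ∑ i ∈ Finset.Ico 1 k, f.1 i ^ 2) *
        (qpT k f.1)⁻¹ *
      (pEval k f.1 P - pEval k f.1 Q) = 0

open Filter Topology

/-- Raising the `i`-th entry of a decreasing tuple by one, when it stays decreasing. -/
def DecTuple.raise {k : ℕ} (f : DecTuple k) (i : ℕ) (hi : i < k)
    (h : 0 < i → f.1 i < f.1 (i - 1)) : DecTuple k :=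
  ⟨Function.update f.1 i (f.1 i + 1), by
    refine ⟨fun a b hab => ?_, fun b hb => ?_⟩
    · by_cases ha : a = i <;> by_cases hb : b = i
      · simp [ha, hb]
      · subst ha
        have := f.2.1 hab
        simp only [Function.update_self, Function.update_of_ne hb]
        omega
      · subst hb
        have h1 := f.2.1 (show a ≤ b - 1 by omega)
        have h2 := h (by omega)
        simp only [Function.update_self, Function.update_of_ne ha]
        omega
      · simpa only [Function.update_of_ne ha, Function.update_of_ne hb] using f.2.1 hab
    · rw [Function.update_of_ne (by omega)]
      exact f.2.2 b hb⟩

/-- Lowering the `i`-th entry of a decreasing tuple by one, when it stays decreasing. -/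
def DecTuple.lower {k : ℕ} (f : DecTuple k) (i : ℕ) (h : f.1 (i + 1) < f.1 i) : DecTuple k :=
  ⟨Function.update f.1 i (f.1 i - 1), by
    refine ⟨fun a b hab => ?_, fun b hb => ?_⟩
    · by_cases ha : a = i <;> by_cases hb : b = i
      · simp [ha, hb]
      · subst ha
        have := f.2.1 (show a + 1 ≤ b by omega)
        simp only [Function.update_self, Function.update_of_ne hb]
        omega
      · subst hb
        have h1 := f.2.1 hab
        simp only [Function.update_self, Function.update_of_ne ha]
        omega
      · simpa only [Function.update_of_ne ha, Function.update_of_ne hb] using f.2.1 hab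
    · have := f.2.2 b hb
      by_cases hbi : b = i
      · subst hbi
        simp [this]
      · rw [Function.update_of_ne hbi, this]⟩

theorem DecTuple.finite_setOf_le (k M : ℕ) : {f : DecTuple k | f.1 0 ≤ M}.Finite := by
  have hinj : Function.Injective (fun (f : {f : DecTuple k | f.1 0 ≤ M}) (j : Fin k) =>
      (⟨f.1.1 j, Nat.lt_succ_of_le ((f.1.2.1 (Nat.zero_le _)).trans f.2)⟩ : Fin (M + 1))) := by
    intro f g h
    refine Subtype.ext (Subtype.ext (funext fun j => ?_))
    by_cases hj : j < k
    · exact Fin.mk.inj_iff.mp (congrFun h ⟨j, hj⟩)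
    · rw [f.1.2.2 j (by omega), g.1.2.2 j (by omega)]
  exact Finite.of_injective _ hinj

/-- The decreasing tuples with largest entry at most `M`. -/
def DecTuple.box (k M : ℕ) : Finset (DecTuple k) := (DecTuple.finite_setOf_le k M).toFinset

theorem DecTuple.mem_box {k M : ℕ} {f : DecTuple k} : f ∈ DecTuple.box k M ↔ f.1 0 ≤ M := by
  simp [DecTuple.box]

theorem DecTuple.tendsto_box (k : ℕ) : Tendsto (DecTuple.box k) atTop atTop := by
  refine tendsto_atTop.mpr fun s => ?_
  filter_upwards [eventually_ge_atTop (s.sup fun f => f.1 0)] with M hM f hf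
  exact DecTuple.mem_box.mpr ((Finset.le_sup (f := fun f : DecTuple k => f.1 0) hf).trans hM)

theorem tendsto_coeff_of_tendsto {ι : Type*} {l : Filter ι} {u : ι → ℚ⟦X⟧} {a : ℚ⟦X⟧}
    (h : Tendsto u l (𝓝 a)) (n : ℕ) :
    Tendsto (fun j => coeff n (u j)) l (𝓝 (coeff n a)) := by
  have hc : Continuous (fun g : (Unit →₀ ℕ) → ℚ => g (Finsupp.single () n)) := continuous_apply _
  exact (hc.tendsto a).comp h

/-- A sum over boxes telescopes along the `i`-th coordinate. -/
theorem sum_box_sub {k i M : ℕ} (hi : i < k) (A B : DecTuple k → ℚ⟦X⟧)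
    (hB : ∀ f, f.1 i = f.1 (i + 1) → B f = 0)
    (hA : ∀ f, 0 < i → f.1 i = f.1 (i - 1) → A f = 0)
    (hAB : ∀ f (h : 0 < i → f.1 i < f.1 (i - 1)), A f = B (f.raise i hi h)) :
    ∑ f ∈ DecTuple.box k M, (A f - B f) =
      ∑ f ∈ (DecTuple.box k M).filter (fun f => i = 0 ∧ f.1 0 = M), A f := by
  classical
  rw [Finset.sum_sub_distrib, sub_eq_iff_eq_add,
    ← Finset.sum_filter_add_sum_filter_not _ (fun f : DecTuple k => i = 0 ∧ f.1 0 = M)]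
  congr 1
  have key : ∀ f : DecTuple k, A f ≠ 0 → 0 < i → f.1 i < f.1 (i - 1) := fun f h h0 =>
    lt_of_le_of_ne (f.2.1 (by omega)) fun he => h (hA f h0 he)
  have key' : ∀ f : DecTuple k, B f ≠ 0 → f.1 (i + 1) < f.1 i := fun f h =>
    lt_of_le_of_ne (f.2.1 (by omega)) fun he => h (hB f he.symm)
  refine Finset.sum_bij_ne_zero (fun f _ h => f.raise i hi (key f h)) ?_ ?_ ?_ ?_
  · intro f hf h
    simp only [Finset.mem_filter, DecTuple.mem_box] at hf ⊢
    by_cases h0 : i = 0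
    · subst h0
      simp only [DecTuple.raise, Function.update_self]
      omega
    · simpa only [DecTuple.raise, Function.update_of_ne (Ne.symm h0)] using hf.1
  · intro f _ _ g _ _ h
    have h' := congrArg Subtype.val h
    simp only [DecTuple.raise] at h'
    refine Subtype.ext (funext fun j => ?_)
    have hj := congrFun h' j
    by_cases hji : j = i
    · subst hji
      simpa using hj
    · simpa only [Function.update_of_ne hji] using hj
  · intro g hg h
    have hlt := key' g h
    have hr : ∀ h', (g.lower i hlt).raise i hi h' = g := by
      intro h'
      refine Subtype.ext (funext fun j => ?_)
      by_cases hji : j = i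
      · subst hji
        simp only [DecTuple.raise, DecTuple.lower, Function.update_self]
        omega
      · simp only [DecTuple.raise, DecTuple.lower, Function.update_of_ne hji]
    have hl : 0 < i → (g.lower i hlt).1 i < (g.lower i hlt).1 (i - 1) := by
      intro h0
      have := g.2.1 (show i - 1 ≤ i by omega)
      simp only [DecTuple.lower, Function.update_self,
        Function.update_of_ne (show i - 1 ≠ i by omega)]
      omega
    refine ⟨g.lower i hlt, ?_, ?_, hr _⟩
    · simp only [Finset.mem_filter, DecTuple.mem_box] at hg ⊢
      by_cases h0 : i = 0
      · subst h0
        simp only [DecTuple.lower, Function.update_self]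
        omega
      · simp only [DecTuple.lower, Function.update_of_ne (Ne.symm h0)]
        exact ⟨hg, fun h' => h0 h'.1⟩
    · rw [hAB _ hl, hr]
      exact h
  · intro f _ h
    exact hAB f _

theorem tsum_sub_eq_zero_of_raise {k i : ℕ} (hi : i < k) (A B : DecTuple k → ℚ⟦X⟧)
    (hB : ∀ f, f.1 i = f.1 (i + 1) → B f = 0)
    (hA : ∀ f, 0 < i → f.1 i = f.1 (i - 1) → A f = 0)
    (hAB : ∀ f (h : 0 < i → f.1 i < f.1 (i - 1)), A f = B (f.raise i hi h))
    (hX : ∀ f, i = 0 → (X : ℚ⟦X⟧) ^ f.1 0 ∣ A f) :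
    ∑' f, (A f - B f) = 0 := by
  by_cases hs : Summable fun f => A f - B f
  · have ht : Tendsto (fun s : Finset (DecTuple k) => ∑ f ∈ s, (A f - B f)) atTop
        (𝓝 (∑' f, (A f - B f))) := by
      simpa [HasSum] using hs.hasSum
    ext n
    refine tendsto_nhds_unique
      (tendsto_coeff_of_tendsto (ht.comp (DecTuple.tendsto_box k)) n) ?_
    refine tendsto_const_nhds.congr' ?_
    filter_upwards [eventually_gt_atTop n] with M hM
    rw [Function.comp_apply, sum_box_sub hi A B hB hA hAB, map_zero, map_sum]
    refine (Finset.sum_eq_zero fun f hf => ?_).symm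
    obtain ⟨-, h0, hfM⟩ := Finset.mem_filter.mp hf
    exact X_pow_dvd_iff.mp (hX f h0) n (by omega)
  · exact tsum_eq_zero_of_not_summable hs

theorem qp_succ (n : ℕ) : qp (n + 1) = qp n * (1 - X ^ (n + 1)) :=
  Finset.prod_range_succ _ _

theorem nqp_succ (n : ℕ) : nqp (n + 1) = nqp n * (1 + X ^ (n + 1)) :=
  Finset.prod_range_succ _ _

theorem constantCoeff_qpT_ne_zero (r : ℕ) (f : ℕ → ℕ) : constantCoeff (qpT r f) ≠ 0 := by
  simp [qpT, qp]

theorem inv_mul_eq_inv_mul_of_mul_eq {a b c d : ℚ⟦X⟧} (ha : constantCoeff a ≠ 0)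
    (hb : constantCoeff b ≠ 0) (h : b * c = a * d) : a⁻¹ * c = b⁻¹ * d := by
  have ha' := PowerSeries.inv_mul_cancel a ha
  have hb' := PowerSeries.inv_mul_cancel b hb
  linear_combination a⁻¹ * b⁻¹ * h + b⁻¹ * d * ha' - a⁻¹ * c * hb'

theorem qpT_update_zero {k : ℕ} (hk : 0 < k) (f : ℕ → ℕ) (h : f 1 ≤ f 0) :
    qpT k (Function.update f 0 (f 0 + 1)) = qpT k f * (1 - X ^ (f 0 + 1 - f 1)) := by
  obtain ⟨m, rfl⟩ : ∃ m, k = m + 1 := ⟨k - 1, by omega⟩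
  simp only [qpT, Finset.prod_range_succ', Function.update_self, Function.update_of_ne,
    ne_eq, Nat.succ_ne_zero, not_false_eq_true]
  rw [zero_add, Nat.sub_add_comm h, qp_succ]
  ring

theorem qpT_update_succ {k j : ℕ} (hj : j + 1 < k) (f : ℕ → ℕ) (h : f (j + 2) ≤ f (j + 1))
    (h' : f (j + 1) < f j) :
    qpT k (Function.update f (j + 1) (f (j + 1) + 1)) * (1 - X ^ (f j - f (j + 1))) =
      qpT k f * (1 - X ^ (f (j + 1) + 1 - f (j + 2))) := by
  have hm : j + 1 ∈ Finset.range k := Finset.mem_range.mpr hj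
  have hm' : j ∈ (Finset.range k).erase (j + 1) :=
    Finset.mem_erase.mpr ⟨by omega, Finset.mem_range.mpr (by omega)⟩
  simp only [qpT]
  rw [← Finset.mul_prod_erase _ _ hm, ← Finset.mul_prod_erase _ _ hm',
    ← Finset.mul_prod_erase _ (fun i => qp (f i - f (i + 1))) hm,
    ← Finset.mul_prod_erase _ (fun i => qp (f i - f (i + 1))) hm']
  have hp : ∏ i ∈ ((Finset.range k).erase (j + 1)).erase j,
      qp (Function.update f (j + 1) (f (j + 1) + 1) i -
        Function.update f (j + 1) (f (j + 1) + 1) (i + 1)) =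
      ∏ i ∈ ((Finset.range k).erase (j + 1)).erase j, qp (f i - f (i + 1)) := by
    refine Finset.prod_congr rfl fun i hi => ?_
    simp only [Finset.mem_erase] at hi
    rw [Function.update_of_ne (by omega), Function.update_of_ne (by omega)]
  rw [hp, Function.update_self, Function.update_of_ne (by omega), Function.update_of_ne (by omega),
    Nat.sub_add_comm h, qp_succ]
  obtain ⟨d, hd⟩ : ∃ d, f j = f (j + 1) + 1 + d := ⟨_, (Nat.add_sub_of_le h').symm⟩
  rw [show f j - f (j + 1) = d + 1 by omega, show f j - (f (j + 1) + 1) = d by omega, qp_succ]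
  ring

theorem sum_sq_update {k i : ℕ} (hi : 1 ≤ i) (hik : i < k) (f : ℕ → ℕ) :
    ∑ j ∈ Finset.Ico 1 k, Function.update f i (f i + 1) j ^ 2 =
      ∑ j ∈ Finset.Ico 1 k, f j ^ 2 + (2 * f i + 1) := by
  have hm : i ∈ Finset.Ico 1 k := Finset.mem_Ico.mpr ⟨hi, hik⟩
  rw [← Finset.add_sum_erase _ _ hm, ← Finset.add_sum_erase _ (fun j => f j ^ 2) hm,
    Function.update_self, Finset.sum_congr rfl fun j hj => by
      rw [Function.update_of_ne (Finset.ne_of_mem_erase hj)]]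
  ring

theorem pEval_update {k i : ℕ} (hi : i < k + 1) (f : ℕ → ℕ) (n : ℕ)
    {P : MvPolynomial (Fin (k + 1)) ℤ} (hP : (⟨i, hi⟩ : Fin (k + 1)) ∉ P.vars) :
    pEval k (Function.update f i n) P = pEval k f P := by
  refine MvPolynomial.eval₂Hom_congr' rfl (fun j hj _ => ?_) rfl
  have hne : (j : ℕ) ≠ i := by
    rintro rfl
    exact hP hj
  simp only [Function.update_of_ne hne]

theorem pEval_mul (k : ℕ) (f : ℕ → ℕ) (P Q : MvPolynomial (Fin (k + 1)) ℤ) :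
    pEval k f (P * Q) = pEval k f P * pEval k f Q := map_mul _ _ _

theorem pEval_add (k : ℕ) (f : ℕ → ℕ) (P Q : MvPolynomial (Fin (k + 1)) ℤ) :
    pEval k f (P + Q) = pEval k f P + pEval k f Q := map_add _ _ _

theorem pEval_one (k : ℕ) (f : ℕ → ℕ) : pEval k f 1 = 1 := map_one _

theorem pEval_qv (k : ℕ) (f : ℕ → ℕ) : pEval k f (qv k) = X := by
  simp [pEval, qv]

theorem pEval_xv_succ {k : ℕ} (f : DecTuple k) (j : ℕ) :
    pEval k f.1 (xv k (j + 1)) = X ^ f.1 j := by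
  by_cases hj : j < k
  · rw [xv, dif_pos ⟨by omega, hj⟩]
    simp [pEval, hj]
  · rw [xv, dif_neg (by omega), if_neg (by omega), pEval_one, f.2.2 j (by omega), pow_zero]

/-- The weight of a tuple in the sum defining `papprox2`. -/
def weight (k : ℕ) (f : ℕ → ℕ) : ℚ⟦X⟧ :=
  nqp (f 0) * (X : ℚ⟦X⟧) ^ (f 0 * (f 0 - 1) / 2 + ∑ i ∈ Finset.Ico 1 k, f i ^ 2) * (qpT k f)⁻¹

theorem weight_update_zero {k : ℕ} (hk : 0 < k) (f : ℕ → ℕ) (h : f 1 ≤ f 0) :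
    weight k (Function.update f 0 (f 0 + 1)) * (1 - X ^ (f 0 + 1 - f 1)) =
      weight k f * (X ^ f 0 * (1 + X ^ (f 0 + 1))) := by
  have hq := inv_mul_eq_inv_mul_of_mul_eq (constantCoeff_qpT_ne_zero k f)
    (constantCoeff_qpT_ne_zero k (Function.update f 0 (f 0 + 1)))
    (c := 1) ((mul_one _).trans (qpT_update_zero hk f h))
  have hs : ∑ j ∈ Finset.Ico 1 k, Function.update f 0 (f 0 + 1) j ^ 2 =
      ∑ j ∈ Finset.Ico 1 k, f j ^ 2 := Finset.sum_congr rfl fun j hj => by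
    rw [Function.update_of_ne (by have := Finset.mem_Ico.mp hj; omega)]
  have ht : (f 0 + 1) * (f 0 + 1 - 1) / 2 = f 0 * (f 0 - 1) / 2 + f 0 := by
    rw [← Nat.triangle_succ]
  simp only [weight, hs, Function.update_self, nqp_succ, ht, pow_add] at hq ⊢
  linear_combination -(nqp (f 0) * (1 + X ^ f 0 * X ^ 1) * (X ^ (f 0 * (f 0 - 1) / 2) * X ^ f 0 *
    X ^ (∑ j ∈ Finset.Ico 1 k, f j ^ 2))) * hq

theorem weight_update_succ {k j : ℕ} (hj : j + 1 < k) (f : ℕ → ℕ) (h : f (j + 2) ≤ f (j + 1))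
    (h' : f (j + 1) < f j) :
    weight k (Function.update f (j + 1) (f (j + 1) + 1)) *
        (1 - X ^ (f (j + 1) + 1 - f (j + 2))) =
      weight k f * (X ^ (2 * f (j + 1) + 1) * (1 - X ^ (f j - f (j + 1)))) := by
  have hq := inv_mul_eq_inv_mul_of_mul_eq (constantCoeff_qpT_ne_zero k f)
    (constantCoeff_qpT_ne_zero k (Function.update f (j + 1) (f (j + 1) + 1)))
    (qpT_update_succ hj f h h')
  simp only [weight, sum_sq_update (show 1 ≤ j + 1 by omega) hj,
    Function.update_of_ne (show 0 ≠ j + 1 by omega), ← add_assoc]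
  rw [pow_add X _ 1, pow_add X _ (2 * f (j + 1)), pow_add X (2 * f (j + 1))]
  linear_combination -(nqp (f 0) * (X ^ (f 0 * (f 0 - 1) / 2 + ∑ j ∈ Finset.Ico 1 k, f j ^ 2) *
    X ^ (2 * f (j + 1)) * X ^ 1)) * hq

theorem papprox2_of_two_le {k j : ℕ} (hj : j + 1 < k) {P : MvPolynomial (Fin (k + 1)) ℤ}
    (hP : (⟨j + 1, by omega⟩ : Fin (k + 1)) ∉ P.vars) :
    papprox2 k (xv k (j + 2) * (1 + qv k * xv k (j + 2) * xv k (j + 3)) * P)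
      (xv k (j + 3) * (1 + qv k * xv k (j + 1) * xv k (j + 2)) * P) := by
  have key := tsum_sub_eq_zero_of_raise hj
    (fun f => weight k f.1 * (X ^ (2 * f.1 (j + 1) + 1) * (1 - X ^ (f.1 j - f.1 (j + 1)))) *
      (X ^ f.1 (j + 2) * pEval k f.1 P))
    (fun f => weight k f.1 * (1 - X ^ (f.1 (j + 1) - f.1 (j + 2))) *
      (X ^ f.1 (j + 2) * pEval k f.1 P))
    (fun f hf => by simp [hf]) (fun f _ hf => by simp [show f.1 (j + 1) = f.1 j from hf])
    (fun f hf => by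
      simp only [DecTuple.raise, pEval_update _ _ _ hP, Function.update_self,
        Function.update_of_ne (show j + 2 ≠ j + 1 by omega)]
      rw [weight_update_succ hj f.1 (f.2.1 (by omega)) (hf (by omega))])
    (fun f hf => by omega)
  refine (tsum_congr fun f => ?_).trans key
  obtain ⟨c, hc⟩ := Nat.exists_eq_add_of_le (f.2.1 (show j + 1 ≤ j + 2 by omega))
  obtain ⟨d, hd⟩ := Nat.exists_eq_add_of_le (f.2.1 (show j ≤ j + 1 by omega))
  simp only [pEval_mul, pEval_add, pEval_one, pEval_qv, pEval_xv_succ, weight]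
  rw [hd, hc, Nat.add_sub_cancel_left, Nat.add_sub_cancel_left]
  ring

theorem papprox2_of_eq_one {k : ℕ} (hk : 0 < k) {P : MvPolynomial (Fin (k + 1)) ℤ}
    (hP : (⟨0, by omega⟩ : Fin (k + 1)) ∉ P.vars) :
    papprox2 k (xv k 1 * (1 + xv k 2 + qv k * xv k 1 * xv k 2) * P) (xv k 2 * P) := by
  have key := tsum_sub_eq_zero_of_raise hk
    (fun f => weight k f.1 * (X ^ f.1 0 * (1 + X ^ (f.1 0 + 1))) * (X ^ f.1 1 * pEval k f.1 P))
    (fun f => weight k f.1 * (1 - X ^ (f.1 0 - f.1 1)) * (X ^ f.1 1 * pEval k f.1 P))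
    (fun f hf => by simp [show f.1 0 = f.1 1 from hf]) (fun f hf => by omega)
    (fun f hf => by
      simp only [DecTuple.raise, pEval_update _ _ _ hP, Function.update_self,
        Function.update_of_ne (show 1 ≠ 0 by omega)]
      rw [weight_update_zero hk f.1 (f.2.1 (by omega))])
    (fun f _ => ((dvd_mul_right _ _).mul_left _).mul_right _)
  refine (tsum_congr fun f => ?_).trans key
  obtain ⟨c, hc⟩ := Nat.exists_eq_add_of_le (f.2.1 (show 0 ≤ 1 by omega))
  simp only [pEval_mul, pEval_add, pEval_one, pEval_qv, pEval_xv_succ f 0, pEval_xv_succ f 1,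
    weight]
  rw [hc, Nat.add_sub_cancel_left]
  ring

/-- Lemma `simple transformation2` (with `x_0 = 0`, `x_{k+1} = 1`). -/
theorem stmt13 (k s : ℕ) (hk : 1 ≤ k) (hs1 : 1 ≤ s) (hs2 : s ≤ k)
    (P : MvPolynomial (Fin (k + 1)) ℤ)
    (hP : (⟨s - 1, by omega⟩ : Fin (k + 1)) ∉ P.vars) :
    (2 ≤ s →
      papprox2 k (xv k s * (1 + qv k * xv k s * xv k (s + 1)) * P)
        (xv k (s + 1) * (1 + qv k * xv k (s - 1) * xv k s) * P)) ∧
    (s = 1 →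
      papprox2 k (xv k 1 * (1 + xv k 2 + qv k * xv k 1 * xv k 2) * P)
        (xv k 2 * P)) := by
  refine ⟨fun h => ?_, ?_⟩
  · obtain ⟨j, rfl⟩ := Nat.exists_eq_add_of_le' h
    exact papprox2_of_two_le (by omega) hP
  · rintro rfl
    exact papprox2_of_eq_one hk hP
end
end
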